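/- Let μ and ν be probability measures on ℝ with finite first moment, let g ∈ ℝ, let γ ∈ (0,1], let f : ℝ → ℝ be a nondecreasing, continuous, L-Lipschitz function with L ≤ 1, and let ρ be a real-valued functional on probability measures on ℝ with finite first moment that is non-expansive with respect to W₁, i.e. |ρ(μ') − ρ(ν')| ≤ W₁(μ', ν') for all such measures μ', ν'. Define the risk-sensitive distributional Bellman operator T by T(μ) = δ_{g − γ·ρ(f_*μ)}, where f_*μ denotes the pushforward of μ under f and δ_a is the Dirac measure at a. Then W₁(T(μ), T(ν)) ≤ γ · W₁(μ, ν); in particular T is a γ-contraction in the Wasserstein-1 metric. -/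

import Mathlib

open MeasureTheory Set

/-- The cumulative distribution function of a measure on `ℝ`: `F_μ(x) = μ((−∞, x])`. -/
noncomputable def cdf (μ : Measure ℝ) (x : ℝ) : ℝ := (μ (Iic x)).toReal

/-- The quantile function `Q_μ(p) = inf {x | F_μ(x) ≥ p}`. -/
noncomputable def quantile (μ : Measure ℝ) (p : ℝ) : ℝ := sInf {x : ℝ | p ≤ cdf μ x}

/-- The Wasserstein-1 distance `W₁(μ, ν) = ∫₀¹ |Q_μ(p) − Q_ν(p)| dp`. -/
noncomputable def W1 (μ ν : Measure ℝ) : ℝ :=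
  ∫ p in Ioo (0:ℝ) 1, |quantile μ p - quantile ν p|

/-- The risk-sensitive distributional Bellman operator `T(μ) = δ_{g − γ·ρ(f_*μ)}`. -/
noncomputable def bellmanT (g γ : ℝ) (f : ℝ → ℝ) (ρ : Measure ℝ → ℝ) (μ : Measure ℝ) :
    Measure ℝ :=
  Measure.dirac (g - γ * ρ (Measure.map f μ))

theorem cdf_eq_probabilityTheory_cdf (μ : Measure ℝ) [IsProbabilityMeasure μ] (x : ℝ) :
    cdf μ x = ProbabilityTheory.cdf μ x := by
  rw [ProbabilityTheory.cdf_eq_real]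
  rfl

theorem monotone_measure_cdf (μ : Measure ℝ) [IsProbabilityMeasure μ] : Monotone (cdf μ) := by
  intro x y hxy
  rw [cdf_eq_probabilityTheory_cdf, cdf_eq_probabilityTheory_cdf]
  exact ProbabilityTheory.monotone_cdf μ hxy

/-- The Galois connection between the quantile function and the distribution function. -/
theorem quantile_le_iff (μ : Measure ℝ) [IsProbabilityMeasure μ] {p : ℝ}
    (hp : p ∈ Ioo (0 : ℝ) 1) (x : ℝ) : quantile μ p ≤ x ↔ p ≤ cdf μ x := by
  have hne : {x : ℝ | p ≤ cdf μ x}.Nonempty := by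
    obtain ⟨y, hy⟩ :=
      ((ProbabilityTheory.tendsto_cdf_atTop μ).eventually (lt_mem_nhds hp.2)).exists
    exact ⟨y, by simpa [cdf_eq_probabilityTheory_cdf] using hy.le⟩
  have hbdd : BddBelow {x : ℝ | p ≤ cdf μ x} := by
    obtain ⟨y, hy⟩ :=
      ((ProbabilityTheory.tendsto_cdf_atBot μ).eventually (gt_mem_nhds hp.1)).exists
    rw [← cdf_eq_probabilityTheory_cdf] at hy
    refine ⟨y, fun z hz => ?_⟩
    by_contra! h
    exact absurd (hz.trans (monotone_measure_cdf μ h.le)) (not_le.2 hy)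
  refine ⟨fun h => ?_, fun h => csInf_le hbdd h⟩
  have hright := ((ProbabilityTheory.cdf μ).right_continuous x).tendsto.mono_left
    (nhdsWithin_mono x Ioi_subset_Ici_self)
  rw [cdf_eq_probabilityTheory_cdf]
  refine ge_of_tendsto hright ?_
  filter_upwards [self_mem_nhdsWithin] with y hy
  obtain ⟨z, hz, hzy⟩ := exists_lt_of_csInf_lt hne (lt_of_le_of_lt h hy)
  rw [← cdf_eq_probabilityTheory_cdf]
  exact le_trans hz (monotone_measure_cdf μ hzy.le)

theorem monotoneOn_quantile (μ : Measure ℝ) [IsProbabilityMeasure μ] :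
    MonotoneOn (quantile μ) (Ioo 0 1) := by
  intro p hp q hq hpq
  rw [quantile_le_iff μ hp]
  exact hpq.trans ((quantile_le_iff μ hq _).1 le_rfl)

theorem aemeasurable_quantile (μ : Measure ℝ) [IsProbabilityMeasure μ] :
    AEMeasurable (quantile μ) (volume.restrict (Ioo 0 1)) :=
  aemeasurable_restrict_of_monotoneOn measurableSet_Ioo (monotoneOn_quantile μ)

/-- The quantile function pushes the uniform measure on `(0, 1)` forward to `μ`. -/
theorem map_quantile (μ : Measure ℝ) [IsProbabilityMeasure μ] :
    Measure.map (quantile μ) (volume.restrict (Ioo 0 1)) = μ := by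
  refine Measure.ext_of_Iic _ _ fun x => ?_
  have h1 : cdf μ x ≤ 1 := by
    rw [cdf_eq_probabilityTheory_cdf]
    exact ProbabilityTheory.cdf_le_one μ x
  rw [Measure.map_apply_of_aemeasurable (aemeasurable_quantile μ) measurableSet_Iic,
    Measure.restrict_apply₀' measurableSet_Ioo.nullMeasurableSet]
  have hset : quantile μ ⁻¹' Iic x ∩ Ioo 0 1 = Iic (cdf μ x) ∩ Ioo 0 1 := by
    ext p
    simp only [mem_inter_iff, mem_preimage, mem_Iic]
    exact and_congr_left fun hp => quantile_le_iff μ hp x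
  have hae : (Iic (cdf μ x) ∩ Ioo 0 1 : Set ℝ) =ᵐ[volume] (Iic (cdf μ x) ∩ Ioc 0 1 : Set ℝ) :=
    (ae_eq_refl _).inter Ioo_ae_eq_Ioc
  rw [hset, measure_congr hae, inter_comm, Ioc_inter_Iic, min_eq_right h1, Real.volume_Ioc,
    sub_zero]
  exact ENNReal.ofReal_toReal (measure_ne_top μ _)

theorem integrableOn_quantile (μ : Measure ℝ) [IsProbabilityMeasure μ]
    (hμ : Integrable (fun x => x) μ) : IntegrableOn (quantile μ) (Ioo 0 1) := by
  rw [← map_quantile μ] at hμ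
  exact hμ.comp_aemeasurable (aemeasurable_quantile μ)

theorem quantile_map (μ : Measure ℝ) [IsProbabilityMeasure μ] {f : ℝ → ℝ} (hf : Monotone f)
    (hc : Continuous f) {p : ℝ} (hp : p ∈ Ioo (0 : ℝ) 1) :
    quantile (Measure.map f μ) p = f (quantile μ p) := by
  have := Measure.isProbabilityMeasure_map (μ := μ) hc.aemeasurable
  have hcdf : ∀ y, cdf (Measure.map f μ) y = μ.real (f ⁻¹' Iic y) := fun y => by
    rw [cdf, Measure.map_apply hc.measurable measurableSet_Iic]
    rfl
  apply le_antisymm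
  · rw [quantile_le_iff _ hp, hcdf]
    exact ((quantile_le_iff μ hp _).1 le_rfl).trans (measureReal_mono fun z hz => hf hz)
  · by_contra! h
    obtain ⟨z, hz, hzf⟩ : ∃ z < quantile μ p, quantile (Measure.map f μ) p < f z := by
      have hev : ∀ᶠ z in nhdsWithin (quantile μ p) (Iio (quantile μ p)),
          quantile (Measure.map f μ) p < f z :=
        (hc.continuousAt.eventually (lt_mem_nhds h)).filter_mono nhdsWithin_le_nhds
      obtain ⟨z, hz, hzq⟩ := (hev.and self_mem_nhdsWithin).exists
      exact ⟨z, hzq, hz⟩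
    refine absurd ((quantile_le_iff μ hp z).2 ?_) (not_le.2 hz)
    have hle := (quantile_le_iff (Measure.map f μ) hp _).1 le_rfl
    rw [hcdf] at hle
    refine hle.trans (measureReal_mono fun w hw => ?_)
    by_contra hwz
    exact absurd ((hf (not_le.1 hwz).le).trans hw) (not_le.2 hzf)

theorem quantile_dirac (a : ℝ) {p : ℝ} (hp : p ∈ Ioo (0 : ℝ) 1) :
    quantile (Measure.dirac a) p = a := by
  refine eq_of_forall_ge_iff fun x => ?_
  rw [quantile_le_iff _ hp, cdf, Measure.dirac_apply' _ measurableSet_Iic]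
  by_cases h : a ≤ x
  · simp [h, hp.2.le]
  · simp [h, hp.1]

theorem W1_dirac (a b : ℝ) : W1 (Measure.dirac a) (Measure.dirac b) = |a - b| := by
  rw [W1, setIntegral_congr_fun (g := fun _ => |a - b|) measurableSet_Ioo fun p hp => by
    simp only [quantile_dirac _ hp]]
  simp

/-- Pushing forward along a nondecreasing `1`-Lipschitz map does not increase `W₁`. -/
theorem W1_map_le (μ ν : Measure ℝ) [IsProbabilityMeasure μ] [IsProbabilityMeasure ν]
    (hμ : Integrable (fun x => x) μ) (hν : Integrable (fun x => x) ν) {f : ℝ → ℝ}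
    (hf : Monotone f) (hc : Continuous f) (hlip : ∀ x y, |f x - f y| ≤ |x - y|) :
    W1 (Measure.map f μ) (Measure.map f ν) ≤ W1 μ ν := by
  refine integral_mono_of_nonneg (Filter.Eventually.of_forall fun _ => abs_nonneg _)
    ((integrableOn_quantile μ hμ).sub (integrableOn_quantile ν hν)).abs ?_
  filter_upwards [ae_restrict_mem measurableSet_Ioo] with p hp
  rw [quantile_map μ hf hc hp, quantile_map ν hf hc hp]
  exact hlip _ _

theorem integrable_id_map (μ : Measure ℝ) [IsFiniteMeasure μ]
    (hμ : Integrable (fun x => x) μ) {f : ℝ → ℝ} (hc : Continuous f)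
    (hlip : ∀ x y, |f x - f y| ≤ |x - y|) : Integrable (fun x => x) (Measure.map f μ) := by
  refine (integrable_map_measure measurable_id.aestronglyMeasurable hc.aemeasurable).2 ?_
  refine ((integrable_const |f 0|).add hμ.abs).mono' hc.aestronglyMeasurable
    (Filter.Eventually.of_forall fun x => ?_)
  have h1 := hlip x 0
  have h2 := abs_sub_abs_le_abs_sub (f x) (f 0)
  simp only [sub_zero] at h1
  simp only [Function.comp_apply, id_eq, Real.norm_eq_abs, Pi.add_apply]
  linarith

/-- Contraction of the risk-sensitive distributional Bellman operator in `W₁`. -/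
theorem bellman_contraction
    (μ ν : Measure ℝ) [IsProbabilityMeasure μ] [IsProbabilityMeasure ν]
    (hμ : Integrable (fun x => x) μ) (hν : Integrable (fun x => x) ν)
    (g γ : ℝ) (hγ : γ ∈ Ioc (0:ℝ) 1)
    (L : ℝ) (hL0 : 0 ≤ L) (hL1 : L ≤ 1)
    (f : ℝ → ℝ) (hf_mono : Monotone f) (hf_cont : Continuous f)
    (hf_lip : ∀ x y : ℝ, |f x - f y| ≤ L * |x - y|)
    (ρ : Measure ℝ → ℝ)
    (hρ : ∀ μ' ν' : Measure ℝ, IsProbabilityMeasure μ' → IsProbabilityMeasure ν' →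
      Integrable (fun x => x) μ' → Integrable (fun x => x) ν' →
      |ρ μ' - ρ ν'| ≤ W1 μ' ν') :
    W1 (bellmanT g γ f ρ μ) (bellmanT g γ f ρ ν) ≤ γ * W1 μ ν := by
  have hlip : ∀ x y : ℝ, |f x - f y| ≤ |x - y| := fun x y =>
    (hf_lip x y).trans (mul_le_of_le_one_left (abs_nonneg _) hL1)
  have hρf := hρ (Measure.map f μ) (Measure.map f ν)
    (Measure.isProbabilityMeasure_map hf_cont.aemeasurable)
    (Measure.isProbabilityMeasure_map hf_cont.aemeasurable)
    (integrable_id_map μ hμ hf_cont hlip) (integrable_id_map ν hν hf_cont hlip)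
  rw [bellmanT, bellmanT, W1_dirac, sub_sub_sub_cancel_left, ← mul_sub, abs_mul,
    abs_of_pos hγ.1, abs_sub_comm]
  exact mul_le_mul_of_nonneg_left
    (hρf.trans (W1_map_le μ ν hμ hν hf_mono hf_cont hlip)) hγ.1.le
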